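/- Let n, r, t be integers with t ≥ 1 and n ≥ 2r+2t+2. Then for the complete graph K_n on n vertices: the minimum size of a t-partial vertex cover equals 1, while there exists y in the level-r Sherali–Adams tightening S^{(r)}(P_t(K_n)) with objective value ∑_{i∈V} y_{{i}} = t·n/C(n−2r,2). Consequently, the integrality gap of the level-r Sherali–Adams tightening of the t-PVC LP relaxation on graphs with n vertices is at least C(n−2r,2)/(t·n). -/

import Mathlib

open Finset
open scoped Classical

noncomputable section

/-- The edges of the complete graph `K_n`: non-diagonal unordered pairs of `Fin n`. -/
abbrev EdgeT (n : ℕ) : Type := {e : Sym2 (Fin n) // ¬ e.IsDiag}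

/-- The LP variables of the `t`-PVC relaxation on `K_n`: vertices ⊕ edges. -/
abbrev PVar (n : ℕ) : Type := Fin n ⊕ EdgeT n

/-- The 0-1 assignment determined by a set `S` of chosen vertices: a vertex variable is 1
iff the vertex is chosen, an edge variable is 1 iff the edge has a chosen endpoint. -/
def Xvar (n : ℕ) (q : PVar n) (S : Finset (Fin n)) : ℝ :=
  match q with
  | Sum.inl i => if i ∈ S then 1 else 0
  | Sum.inr e => if ∃ i ∈ S, i ∈ e.1 then 1 else 0

/-- The probability, under the distribution `D_p` (each vertex chosen independently with
probability `p`), of the set of chosen vertices being exactly `S`. -/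
def μD (n : ℕ) (p : ℝ) (S : Finset (Fin n)) : ℝ :=
  p ^ S.card * (1 - p) ^ (n - S.card)

/-- Expectation with respect to `D_p`. -/
def ED (n : ℕ) (p : ℝ) (f : Finset (Fin n) → ℝ) : ℝ :=
  ∑ S : Finset (Fin n), μD n p S * f S

/-- `y_A = Pr_{D_p}[X_q = 1 for all q ∈ A]`. -/
def yD (n : ℕ) (p : ℝ) (A : Finset (PVar n)) : ℝ :=
  ∑ S : Finset (Fin n), if ∀ q ∈ A, Xvar n q S = 1 then μD n p S else 0

/-- The value `p = t / C(n - 2r, 2)`. -/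
def pval (n r t : ℕ) : ℝ := (t : ℝ) / (Nat.choose (n - 2 * r) 2)

/-- The linearization `w_{Y,N} = ∑_{T ⊆ N} (-1)^{|T|} y_{Y ∪ T}`. -/
def wSA {α : Type*} [DecidableEq α] (y : Finset α → ℝ) (Y N : Finset α) : ℝ :=
  ∑ T ∈ N.powerset, (-1 : ℝ) ^ T.card * y (Y ∪ T)

/-- Membership of `y` in the level-`r` Sherali–Adams tightening `S^{(r)}(P_t(K_n))` of
the `t`-partial-vertex-cover polytope of the complete graph `K_n`. -/
def SAmem (n t r : ℕ) (y : Finset (PVar n) → ℝ) : Prop :=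
  y ∅ = 1 ∧
  ∀ Y N : Finset (PVar n), (Y ∪ N).card ≤ r →
    (∀ (e : EdgeT n) (i j : Fin n), e.1 = s(i, j) →
      wSA y (Y ∪ {Sum.inl i}) N + wSA y (Y ∪ {Sum.inl j}) N
        ≥ wSA y (Y ∪ {Sum.inr e}) N) ∧
    ((∑ e : EdgeT n, wSA y (Y ∪ {Sum.inr e}) N) ≥ (t : ℝ) * wSA y Y N) ∧
    (∀ q : PVar n, 0 ≤ wSA y (Y ∪ {q}) N ∧ wSA y (Y ∪ {q}) N ≤ wSA y Y N)

/-- The number of edges of `K_n` covered by (i.e. incident to) the vertex set `S`. -/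
def covered (n : ℕ) (S : Finset (Fin n)) : ℕ :=
  (Finset.univ.filter (fun e : EdgeT n => ∃ i ∈ S, i ∈ e.1)).card

/-- The indicator of the event that every variable of `Y` is 1 and every variable of `N` is 0. -/
def eventInd (n : ℕ) (Y N : Finset (PVar n)) (S : Finset (Fin n)) : ℝ :=
  (∏ q ∈ Y, Xvar n q S) * ∏ q ∈ N, (1 - Xvar n q S)

/-- The vertices a variable depends on. -/
def touched (n : ℕ) : PVar n → Finset (Fin n)
  | Sum.inl i => {i}
  | Sum.inr e => univ.filter (fun i => i ∈ e.1)

lemma Xvar_eq_zero_or_one (n : ℕ) (q : PVar n) (S : Finset (Fin n)) :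
    Xvar n q S = 0 ∨ Xvar n q S = 1 := by
  rcases q with i | e
  · by_cases h : i ∈ S <;> simp [Xvar, h]
  · by_cases h : ∃ i ∈ S, i ∈ e.1
    · right; simp only [Xvar, if_pos h]
    · left; simp only [Xvar, if_neg h]

lemma Xvar_nonneg (n : ℕ) (q : PVar n) (S : Finset (Fin n)) : 0 ≤ Xvar n q S := by
  rcases Xvar_eq_zero_or_one n q S with h | h <;> simp [h]

lemma Xvar_le_one (n : ℕ) (q : PVar n) (S : Finset (Fin n)) : Xvar n q S ≤ 1 := by
  rcases Xvar_eq_zero_or_one n q S with h | h <;> simp [h]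

lemma Xvar_edge_le_add (n : ℕ) (e : EdgeT n) (i j : Fin n) (he : e.1 = s(i, j))
    (S : Finset (Fin n)) :
    Xvar n (Sum.inr e) S ≤ Xvar n (Sum.inl i) S + Xvar n (Sum.inl j) S := by
  by_cases hi : i ∈ S
  · have h : Xvar n (Sum.inl i) S = 1 := by simp [Xvar, hi]
    have := Xvar_nonneg n (Sum.inl j) S
    linarith [Xvar_le_one n (Sum.inr e) S]
  by_cases hj : j ∈ S
  · have h : Xvar n (Sum.inl j) S = 1 := by simp [Xvar, hj]
    have := Xvar_nonneg n (Sum.inl i) S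
    linarith [Xvar_le_one n (Sum.inr e) S]
  · have h : ¬ ∃ x ∈ S, x ∈ e.1 := by
      rintro ⟨x, hx, hxe⟩
      rw [he, Sym2.mem_iff] at hxe
      rcases hxe with rfl | rfl <;> contradiction
    simp only [Xvar, if_neg h, if_neg hi, if_neg hj, add_zero, le_refl]

lemma Xvar_vertex_le_edge (n : ℕ) (e : EdgeT n) (i : Fin n) (hi : i ∈ e.1)
    (S : Finset (Fin n)) : Xvar n (Sum.inl i) S ≤ Xvar n (Sum.inr e) S := by
  by_cases h : i ∈ S
  · have : ∃ i ∈ S, i ∈ e.1 := ⟨i, h, hi⟩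
    simp only [Xvar, if_pos h, if_pos this, le_refl]
  · have := Xvar_nonneg n (Sum.inr e) S
    simpa only [Xvar, if_neg h] using this

lemma Xvar_insert (n : ℕ) (q : PVar n) (i : Fin n) (hi : i ∉ touched n q)
    (S : Finset (Fin n)) : Xvar n q (insert i S) = Xvar n q S := by
  rcases q with k | e
  · have : k ≠ i := by
      rintro rfl
      simp [touched] at hi
    simp [Xvar, this]
  · have : i ∉ e.1 := by simpa [touched] using hi
    simp [Xvar, this]

lemma card_touched_le (n : ℕ) (q : PVar n) : (touched n q).card ≤ 2 := by
  rcases q with i | ⟨e, he⟩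
  · simp [touched]
  · induction e with
    | _ a b =>
      refine (card_le_card (t := {a, b}) ?_).trans card_le_two
      intro x hx
      simpa [touched] using hx

lemma prod_Xvar (n : ℕ) (A : Finset (PVar n)) (S : Finset (Fin n)) :
    ∏ q ∈ A, Xvar n q S = if ∀ q ∈ A, Xvar n q S = 1 then 1 else 0 := by
  split_ifs with h
  · exact prod_eq_one h
  · push Not at h
    obtain ⟨q, hq, hne⟩ := h
    exact prod_eq_zero hq ((Xvar_eq_zero_or_one n q S).resolve_right hne)

lemma prod_Xvar_union (n : ℕ) (A B : Finset (PVar n)) (S : Finset (Fin n)) :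
    ∏ q ∈ A ∪ B, Xvar n q S = (∏ q ∈ A, Xvar n q S) * ∏ q ∈ B, Xvar n q S := by
  simp only [prod_Xvar, mem_union, or_imp, forall_and]
  split_ifs <;> simp_all

lemma yD_eq_ED (n : ℕ) (p : ℝ) (A : Finset (PVar n)) :
    yD n p A = ED n p (fun S => ∏ q ∈ A, Xvar n q S) := by
  simp only [yD, ED, prod_Xvar, mul_ite, mul_one, mul_zero]

lemma wSA_yD (n : ℕ) (p : ℝ) (Y N : Finset (PVar n)) :
    wSA (yD n p) Y N = ED n p (eventInd n Y N) := by
  simp only [wSA, yD_eq_ED, ED, mul_sum]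
  rw [sum_comm]
  refine sum_congr rfl fun S _ => ?_
  have h : ∏ q ∈ N, (1 - Xvar n q S)
      = ∑ T ∈ N.powerset, (-1 : ℝ) ^ T.card * ∏ q ∈ T, Xvar n q S := by
    simp only [sub_eq_add_neg, prod_one_add, prod_neg]
  rw [eventInd, h, mul_sum, mul_sum]
  refine sum_congr rfl fun T _ => ?_
  rw [prod_Xvar_union]
  ring

lemma eventInd_nonneg (n : ℕ) (Y N : Finset (PVar n)) (S : Finset (Fin n)) :
    0 ≤ eventInd n Y N S :=
  mul_nonneg (prod_nonneg fun q _ => Xvar_nonneg n q S)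
    (prod_nonneg fun q _ => sub_nonneg.2 (Xvar_le_one n q S))

lemma eventInd_union_singleton (n : ℕ) (Y N : Finset (PVar n)) (q : PVar n)
    (S : Finset (Fin n)) :
    eventInd n (Y ∪ {q}) N S = Xvar n q S * eventInd n Y N S := by
  simp only [eventInd, prod_Xvar_union, prod_singleton]
  ring

lemma eventInd_insert (n : ℕ) (Y N : Finset (PVar n)) (i : Fin n)
    (hi : i ∉ (Y ∪ N).biUnion (touched n)) (S : Finset (Fin n)) :
    eventInd n Y N (insert i S) = eventInd n Y N S := by
  simp only [mem_biUnion, mem_union, not_exists, not_and] at hi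
  rw [eventInd, eventInd, prod_congr rfl fun q hq => Xvar_insert n q i (hi q (Or.inl hq)) S,
    prod_congr rfl fun q hq => congrArg (1 - ·) (Xvar_insert n q i (hi q (Or.inr hq)) S)]

lemma μD_nonneg (n : ℕ) {p : ℝ} (h0 : 0 ≤ p) (h1 : p ≤ 1) (S : Finset (Fin n)) :
    0 ≤ μD n p S :=
  mul_nonneg (pow_nonneg h0 _) (pow_nonneg (sub_nonneg.2 h1) _)

lemma ED_mono (n : ℕ) {p : ℝ} (h0 : 0 ≤ p) (h1 : p ≤ 1) {f g : Finset (Fin n) → ℝ}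
    (h : ∀ S, f S ≤ g S) : ED n p f ≤ ED n p g :=
  sum_le_sum fun S _ => mul_le_mul_of_nonneg_left (h S) (μD_nonneg n h0 h1 S)

lemma ED_one (n : ℕ) (p : ℝ) : ED n p (fun _ => 1) = 1 := by
  simp only [ED, μD, mul_one, Fin.sum_pow_mul_eq_add_pow]
  simp

/-- Membership of `i` is independent of any function of the other vertices. -/
lemma ED_vertex_mul (n : ℕ) (p : ℝ) (i : Fin n) (f : Finset (Fin n) → ℝ)
    (hf : ∀ S, f (insert i S) = f S) :
    ED n p (fun S => Xvar n (Sum.inl i) S * f S) = p * ED n p f := by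
  have hpair : ∀ g : Finset (Fin n) → ℝ, ED n p g
      = ∑ S ∈ (univ.erase i).powerset, (μD n p S * g S + μD n p (insert i S) * g (insert i S)) := by
    intro g
    have := sum_powerset_insert (notMem_erase i univ) (fun S => μD n p S * g S)
    rw [insert_erase (mem_univ i), powerset_univ] at this
    rw [ED, this, sum_add_distrib]
  rw [hpair, hpair, mul_sum]
  refine sum_congr rfl fun S hS => ?_
  have hi : i ∉ S := fun h => notMem_erase i univ (mem_powerset.1 hS h)
  have hc : S.card + 1 ≤ n := by
    have := card_le_univ (insert i S)
    rwa [card_insert_of_notMem hi, Fintype.card_fin] at this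
  obtain ⟨k, hk⟩ := Nat.exists_eq_add_of_le hc
  simp only [Xvar, hi, hf, μD, card_insert_of_notMem hi, mem_insert_self, if_true, if_false]
  rw [show n - S.card = k + 1 by omega, show n - (S.card + 1) = k by omega]
  ring

/-- The edges of `K_n` inside `W` number `|W|` choose 2. -/
lemma card_edges_inside (n : ℕ) (W : Finset (Fin n)) :
    (univ.filter (fun e : EdgeT n => ∀ i ∈ e.1, i ∈ W)).card = W.card.choose 2 := by
  rw [← Sym2.card_image_offDiag, ← card_map (Function.Embedding.subtype _)]
  congr 1
  ext e
  induction e with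
  | _ a b =>
    simp only [mem_map, mem_filter, mem_univ, true_and, mem_image, mem_offDiag, Prod.exists,
      Function.Embedding.subtype_apply, Function.uncurry_apply_pair]
    constructor
    · rintro ⟨⟨e, he⟩, h, rfl⟩
      exact ⟨a, b, ⟨h a (Sym2.mem_mk_left a b), h b (Sym2.mem_mk_right a b), he⟩, rfl⟩
    · rintro ⟨c, d, ⟨hc, hd, hcd⟩, h⟩
      refine ⟨⟨s(a, b), ?_⟩, ?_, rfl⟩
      · rw [← h, Sym2.mk_isDiag_iff]
        exact hcd
      · intro x hx
        replace hx : x ∈ s(c, d) := h ▸ hx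
        rcases Sym2.mem_iff.1 hx with rfl | rfl <;> assumption

lemma sum_edges_ge (n r : ℕ) {p : ℝ} (h0 : 0 ≤ p) (h1 : p ≤ 1) (Y N : Finset (PVar n))
    (hYN : (Y ∪ N).card ≤ r) :
    ((n - 2 * r).choose 2 : ℝ) * p * wSA (yD n p) Y N
      ≤ ∑ e : EdgeT n, wSA (yD n p) (Y ∪ {Sum.inr e}) N := by
  set U := (Y ∪ N).biUnion (touched n) with hU
  have hUc : U.card ≤ 2 * r := by
    have := card_biUnion_le_card_mul (Y ∪ N) (touched n) 2 fun q _ => card_touched_le n q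
    rw [← hU] at this
    omega
  have hWc : n - 2 * r ≤ (univ \ U).card := by
    rw [card_univ_sdiff, Fintype.card_fin]
    omega
  have hnn : ∀ Y, 0 ≤ wSA (yD n p) Y N := fun Y => by
    rw [wSA_yD]
    exact sum_nonneg fun S _ => mul_nonneg (μD_nonneg n h0 h1 S) (eventInd_nonneg n Y N S)
  set F := univ.filter (fun e : EdgeT n => ∀ i ∈ e.1, i ∈ univ \ U) with hF
  have hFc : ((n - 2 * r).choose 2 : ℝ) ≤ F.card := by
    rw [hF, card_edges_inside]
    exact_mod_cast Nat.choose_le_choose 2 hWc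
  calc ((n - 2 * r).choose 2 : ℝ) * p * wSA (yD n p) Y N
      ≤ F.card * p * wSA (yD n p) Y N := by
        gcongr
        exact hnn Y
    _ = ∑ _e ∈ F, p * wSA (yD n p) Y N := by rw [sum_const, nsmul_eq_mul, mul_assoc]
    _ ≤ ∑ e ∈ F, wSA (yD n p) (Y ∪ {Sum.inr e}) N := by
        refine sum_le_sum fun e he => ?_
        have hi : e.1.out.1 ∈ e.1 := Sym2.out_fst_mem e.1
        have hiU : e.1.out.1 ∉ U := (mem_sdiff.1 ((mem_filter.1 he).2 _ hi)).2
        rw [wSA_yD, wSA_yD, ← ED_vertex_mul n p _ _ (eventInd_insert n Y N _ hiU)]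
        refine ED_mono n h0 h1 fun S => ?_
        rw [eventInd_union_singleton]
        exact mul_le_mul_of_nonneg_right (Xvar_vertex_le_edge n e _ hi S)
          (eventInd_nonneg n Y N S)
    _ ≤ ∑ e : EdgeT n, wSA (yD n p) (Y ∪ {Sum.inr e}) N :=
        sum_le_sum_of_subset_of_nonneg (subset_univ F) fun e _ _ => hnn _

lemma yD_vertex (n : ℕ) (p : ℝ) (i : Fin n) : yD n p {Sum.inl i} = p := by
  have := ED_vertex_mul n p i (fun _ => 1) fun _ => rfl
  rw [ED_one] at this
  simpa [yD_eq_ED] using this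

lemma SAmem_yD (n t r : ℕ) {p : ℝ} (h0 : 0 ≤ p) (h1 : p ≤ 1)
    (ht : (t : ℝ) = (n - 2 * r).choose 2 * p) : SAmem n t r (yD n p) := by
  refine ⟨?_, fun Y N hYN => ⟨fun e i j he => ?_, ?_, fun q => ⟨?_, ?_⟩⟩⟩
  · simpa [yD_eq_ED] using ED_one n p
  · have hadd : ∀ f g : Finset (Fin n) → ℝ, ED n p f + ED n p g = ED n p (fun S => f S + g S) := by
      intro f g
      simp only [ED, mul_add, sum_add_distrib]
    rw [wSA_yD, wSA_yD, wSA_yD, hadd]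
    refine ED_mono n h0 h1 fun S => ?_
    simp only [eventInd_union_singleton, ← add_mul]
    exact mul_le_mul_of_nonneg_right (Xvar_edge_le_add n e i j he S) (eventInd_nonneg n Y N S)
  · rw [ht]
    exact sum_edges_ge n r h0 h1 Y N hYN
  · rw [wSA_yD]
    exact sum_nonneg fun S _ => mul_nonneg (μD_nonneg n h0 h1 S) (eventInd_nonneg n _ N S)
  · rw [wSA_yD, wSA_yD]
    refine ED_mono n h0 h1 fun S => ?_
    rw [eventInd_union_singleton]
    exact mul_le_of_le_one_left (eventInd_nonneg n Y N S) (Xvar_le_one n q S)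

lemma le_covered_singleton (n : ℕ) (v : Fin n) : n - 1 ≤ covered n {v} := by
  have hc : (univ.erase v).card = n - 1 := by simp
  rw [← hc, covered]
  refine card_le_card_of_surjOn (fun e => if h : v ∈ e.1 then Sym2.Mem.other h else v) ?_
  intro w hw
  have hne : v ≠ w := (ne_of_mem_erase hw).symm
  refine ⟨⟨s(v, w), hne⟩, by simp, ?_⟩
  have hv : v ∈ s(v, w) := Sym2.mem_mk_left v w
  simp only [dif_pos hv]
  exact Sym2.congr_right.1 (Sym2.other_spec hv)

lemma one_le_card_of_le_covered {n t : ℕ} (ht : 1 ≤ t) (S : Finset (Fin n))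
    (hS : t ≤ covered n S) : 1 ≤ S.card := by
  rw [Nat.one_le_iff_ne_zero, Ne, card_eq_zero]
  rintro rfl
  simp [covered] at hS
  omega

theorem stmt6 (n r t : ℕ) (ht : 1 ≤ t) (hn : 2 * r + 2 * t + 2 ≤ n) :
    (∃ S : Finset (Fin n), S.card = 1 ∧ t ≤ covered n S) ∧
    (∀ S : Finset (Fin n), t ≤ covered n S → 1 ≤ S.card) ∧
    (∃ y : Finset (PVar n) → ℝ, SAmem n t r y ∧
      (∑ i : Fin n, y {Sum.inl i}) = (t : ℝ) * n / (Nat.choose (n - 2 * r) 2) ∧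
      ∀ S : Finset (Fin n), t ≤ covered n S →
        ((Nat.choose (n - 2 * r) 2 : ℝ)) / ((t : ℝ) * n)
          ≤ (S.card : ℝ) / (∑ i : Fin n, y {Sum.inl i})) := by
  have hn0 : 0 < n := by omega
  have hC : t ≤ (n - 2 * r).choose 2 := by
    have h1 : (t + 1).choose 1 ≤ (t + 2).choose 2 := by
      rw [Nat.choose_succ_succ (t + 1) 1]
      omega
    rw [Nat.choose_one_right] at h1
    have h2 := Nat.choose_le_choose 2 (show t + 2 ≤ n - 2 * r by omega)
    omega
  have ht0 : (0 : ℝ) < t := by exact_mod_cast ht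
  have hnR : (0 : ℝ) < n := by exact_mod_cast hn0
  have hCR : (0 : ℝ) < (n - 2 * r).choose 2 := by
    exact_mod_cast (by omega : 0 < (n - 2 * r).choose 2)
  have hobj : ∑ i : Fin n, yD n (pval n r t) {Sum.inl i} = (t : ℝ) * n / (n - 2 * r).choose 2 := by
    simp only [yD_vertex, sum_const, card_univ, Fintype.card_fin, nsmul_eq_mul, pval]
    ring
  refine ⟨⟨{⟨0, hn0⟩}, card_singleton _, ?_⟩, fun S => one_le_card_of_le_covered ht S,
    yD n (pval n r t), SAmem_yD n t r (div_nonneg ht0.le hCR.le) ?_ ?_, hobj, fun S hS => ?_⟩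
  · exact le_trans (by omega) (le_covered_singleton n ⟨0, hn0⟩)
  · rw [pval, div_le_one hCR]
    exact_mod_cast hC
  · rw [pval, mul_div_cancel₀ _ hCR.ne']
  · have h1 : (1 : ℝ) ≤ S.card := by exact_mod_cast one_le_card_of_le_covered ht S hS
    rw [hobj, ← one_div_div]
    gcongr

end
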